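/- Let τ_s > 0 and γ > 0. The Huber map H_γ(A) := γ τ_s A / max(τ_s, γ|A|) is monotone on ℝ^{d×d}: for all matrices A, B ∈ ℝ^{d×d}, ⟨H_γ(A) − H_γ(B), A − B⟩ ≥ 0, where ⟨·,·⟩ is the Frobenius inner product. -/

import Mathlib

open MeasureTheory Real Set

/-- The Frobenius inner product on real `d × d` matrices: `⟨A,B⟩ = tr (A Bᵀ)`. -/
noncomputable def frobInner {d : ℕ} (A B : Matrix (Fin d) (Fin d) ℝ) : ℝ :=
  Matrix.trace (A * Matrix.transpose B)

/-- The Frobenius norm `|A| = √⟨A,A⟩`. -/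
noncomputable def frobNorm {d : ℕ} (A : Matrix (Fin d) (Fin d) ℝ) : ℝ :=
  Real.sqrt (frobInner A A)

/-- The Huber-regularized modulus `|A|_γ = max (τ_s, γ |A|)`. -/
noncomputable def huberMod {d : ℕ} (τs γ : ℝ) (A : Matrix (Fin d) (Fin d) ℝ) : ℝ :=
  max τs (γ * frobNorm A)

/-- The Huber map `H_γ(A) = γ τ_s A / |A|_γ`. -/
noncomputable def huberMap {d : ℕ} (τs γ : ℝ) (A : Matrix (Fin d) (Fin d) ℝ) :
    Matrix (Fin d) (Fin d) ℝ :=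
  (γ * τs / huberMod τs γ A) • A

theorem frobInner_eq_sum {d : ℕ} (A B : Matrix (Fin d) (Fin d) ℝ) :
    frobInner A B = ∑ p : Fin d × Fin d, A p.1 p.2 * B p.1 p.2 := by
  simp [frobInner, Matrix.trace, Matrix.mul_apply, Fintype.sum_prod_type]

theorem frobInner_self_nonneg {d : ℕ} (A : Matrix (Fin d) (Fin d) ℝ) : 0 ≤ frobInner A A := by
  rw [frobInner_eq_sum]
  exact Finset.sum_nonneg fun p _ => mul_self_nonneg _

theorem frobNorm_nonneg {d : ℕ} (A : Matrix (Fin d) (Fin d) ℝ) : 0 ≤ frobNorm A :=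
  Real.sqrt_nonneg _

theorem frobNorm_sq {d : ℕ} (A : Matrix (Fin d) (Fin d) ℝ) : frobNorm A ^ 2 = frobInner A A :=
  Real.sq_sqrt (frobInner_self_nonneg A)

/-- The Cauchy–Schwarz inequality for the Frobenius inner product. -/
theorem frobInner_le_frobNorm_mul {d : ℕ} (A B : Matrix (Fin d) (Fin d) ℝ) :
    frobInner A B ≤ frobNorm A * frobNorm B := by
  simp only [frobNorm, frobInner_eq_sum, ← pow_two]
  exact Real.sum_mul_le_sqrt_mul_sqrt _ _ _

theorem frobInner_smul_sub_smul_sub {d : ℕ} (a b : ℝ) (A B : Matrix (Fin d) (Fin d) ℝ) :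
    frobInner (a • A - b • B) (A - B) =
      a * frobInner A A + b * frobInner B B - (a + b) * frobInner A B := by
  simp only [frobInner_eq_sum, Finset.mul_sum, ← Finset.sum_add_distrib, ← Finset.sum_sub_distrib]
  refine Finset.sum_congr rfl fun p _ => ?_
  simp only [Matrix.sub_apply, Matrix.smul_apply, smul_eq_mul]
  ring

theorem div_max_mul_le_div_max_mul {τ γ x y : ℝ} (hτ : 0 < τ) (hx : 0 ≤ x)
    (hxy : x ≤ y) : x / max τ (γ * x) ≤ y / max τ (γ * y) := by
  rw [div_le_div_iff₀ (lt_max_of_lt_left hτ) (lt_max_of_lt_left hτ),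
    mul_max_of_nonneg _ _ hx, mul_max_of_nonneg _ _ (hx.trans hxy)]
  exact max_le_max (mul_le_mul_of_nonneg_right hxy hτ.le) (by linarith)

theorem huberMap_monotone {d : ℕ} (τs γ : ℝ) (hτ : 0 < τs) (hγ : 0 < γ)
    (A B : Matrix (Fin d) (Fin d) ℝ) :
    0 ≤ frobInner (huberMap τs γ A - huberMap τs γ B) (A - B) := by
  have hc : 0 ≤ γ * τs := (mul_pos hγ hτ).le
  have hmod (C : Matrix (Fin d) (Fin d) ℝ) : 0 < huberMod τs γ C := lt_max_of_lt_left hτ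
  have hdiv : 0 ≤ (frobNorm A / huberMod τs γ A - frobNorm B / huberMod τs γ B) *
      (frobNorm A - frobNorm B) := by
    rcases le_total (frobNorm A) (frobNorm B) with h | h
    · exact mul_nonneg_of_nonpos_of_nonpos
        (sub_nonpos.2 (div_max_mul_le_div_max_mul hτ (frobNorm_nonneg A) h)) (sub_nonpos.2 h)
    · exact mul_nonneg
        (sub_nonneg.2 (div_max_mul_le_div_max_mul hτ (frobNorm_nonneg B) h)) (sub_nonneg.2 h)
  have hcs := mul_le_mul_of_nonneg_left (frobInner_le_frobNorm_mul A B)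
    (add_nonneg (div_nonneg hc (hmod A).le) (div_nonneg hc (hmod B).le))
  rw [huberMap, huberMap, frobInner_smul_sub_smul_sub, ← frobNorm_sq, ← frobNorm_sq]
  refine (mul_nonneg hc hdiv).trans ?_
  calc _ = γ * τs / huberMod τs γ A * frobNorm A ^ 2 + γ * τs / huberMod τs γ B * frobNorm B ^ 2 -
        (γ * τs / huberMod τs γ A + γ * τs / huberMod τs γ B) *
          (frobNorm A * frobNorm B) := by ring
    _ ≤ _ := sub_le_sub_left hcs _
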